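/- Let (𝒫, ℒ) and (𝒫′, ℒ′) be linear spaces with dim(𝒫, ℒ) ≥ 3 and dim(𝒫′, ℒ′) ≥ 3, and let φ : ℒ → ℒ′ be a bijection such that a ∼ b if and only if φ(a) ∼′ φ(b) for all a, b ∈ ℒ. If φ maps some star of lines of (𝒫, ℒ) onto a coplanar maximal related set of (𝒫′, ℒ′), then (𝒫, ℒ) is itself a 3-dimensional generalized projective space. -/

import Mathlib

/-- A linear space: a point set `P` together with a set of lines (subsets of `P`),
each line having at least two points, and any two distinct points lying on
exactly one line. -/
structure LinearSpace (P : Type*) where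
  lines : Set (Set P)
  two_points : ∀ l ∈ lines, ∃ A B : P, A ≠ B ∧ A ∈ l ∧ B ∈ l
  unique_line : ∀ A B : P, A ≠ B → ∃! l, l ∈ lines ∧ A ∈ l ∧ B ∈ l

namespace LinearSpace

variable {P : Type*} (LS : LinearSpace P)

/-- A subspace: a subset containing, with any two of its distinct points,
the line joining them. -/
def IsSubspace (S : Set P) : Prop :=
  ∀ l ∈ LS.lines, ∀ A ∈ l, ∀ B ∈ l, A ≠ B → A ∈ S → B ∈ S → l ⊆ S

/-- The span of a subset: the intersection of all subspaces containing it. -/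
def span (S : Set P) : Set P :=
  ⋂₀ {T | LS.IsSubspace T ∧ S ⊆ T}

/-- The dimension of a subset `S` (intended for subspaces):
`min {#X - 1 | X ⊆ S, span X = S}` as an extended natural number. -/
noncomputable def sdim (S : Set P) : ℕ∞ :=
  sInf {d : ℕ∞ | ∃ X : Set P, X ⊆ S ∧ LS.span X = S ∧ d = X.encard - 1}

/-- The dimension of the linear space: `min {#X - 1 | span X = P}`. -/
noncomputable def dim : ℕ∞ := LS.sdim Set.univ

/-- A plane is a 2-dimensional subspace. -/
def IsPlane (E : Set P) : Prop := LS.IsSubspace E ∧ LS.sdim E = 2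

/-- A generalized projective space: every plane is a generalized projective
plane, i.e. any two distinct lines contained in a common plane meet. -/
def IsGenProjSpace : Prop :=
  ∀ E : Set P, LS.IsPlane E →
    ∀ l ∈ LS.lines, ∀ m ∈ LS.lines, l ⊆ E → m ⊆ E → l ≠ m → (l ∩ m).Nonempty

/-- A related set: a set of lines which pairwise meet. -/
def IsRelatedSet (N : Set (Set P)) : Prop :=
  N ⊆ LS.lines ∧ ∀ a ∈ N, ∀ b ∈ N, (a ∩ b).Nonempty

/-- A maximal related set: a related set maximal with respect to inclusion. -/
def IsMaxRelatedSet (M : Set (Set P)) : Prop :=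
  LS.IsRelatedSet M ∧ ∀ N, LS.IsRelatedSet N → M ⊆ N → N = M

/-- The star of lines with vertex `A`: all lines through `A`. -/
def star (A : P) : Set (Set P) := {l | l ∈ LS.lines ∧ A ∈ l}

/-- The pencil of planes with axis `a`: all planes containing `a`. -/
def pencil (a : Set P) : Set (Set P) := {E | LS.IsPlane E ∧ a ⊆ E}

/-- A collineation: a bijection of the point sets mapping each line onto a
line, and whose inverse does likewise. -/
def IsCollineation {P' : Type*} (LS' : LinearSpace P') (κ : P → P') : Prop :=
  Function.Bijective κ ∧ (∀ l ∈ LS.lines, κ '' l ∈ LS'.lines) ∧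
    (∀ l' ∈ LS'.lines, κ ⁻¹' l' ∈ LS.lines)

end LinearSpace

namespace LinearSpace

variable {P P' : Type*} {LS : LinearSpace P} {LS' : LinearSpace P'}

theorem eq_of_mem {l m : Set P} (hl : l ∈ LS.lines) (hm : m ∈ LS.lines) {A B : P} (hAB : A ≠ B)
    (hAl : A ∈ l) (hBl : B ∈ l) (hAm : A ∈ m) (hBm : B ∈ m) : l = m :=
  (LS.unique_line A B hAB).unique ⟨hl, hAl, hBl⟩ ⟨hm, hAm, hBm⟩

theorem exists_line (LS : LinearSpace P) {A B : P} (h : A ≠ B) : ∃ l ∈ LS.lines, A ∈ l ∧ B ∈ l :=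
  (LS.unique_line A B h).exists

theorem exists_mem_ne {l : Set P} (hl : l ∈ LS.lines) (A : P) : ∃ B ∈ l, B ≠ A := by
  obtain ⟨B, C, hBC, hB, hC⟩ := LS.two_points l hl
  by_cases h : B = A
  · exact ⟨C, hC, fun h' => hBC (h.trans h'.symm)⟩
  · exact ⟨B, hB, h⟩

theorem nonempty_of_mem_lines {l : Set P} (hl : l ∈ LS.lines) : l.Nonempty := by
  obtain ⟨A, _, _, hA, _⟩ := LS.two_points l hl
  exact ⟨A, hA⟩

theorem subset_span (X : Set P) : X ⊆ LS.span X := fun _ hx _ hT => hT.2 hx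

theorem isSubspace_span (X : Set P) : LS.IsSubspace (LS.span X) :=
  fun l hl A hA B hB hAB hAX hBX _ hC T hT =>
    hT.1 l hl A hA B hB hAB (hAX T hT) (hBX T hT) hC

theorem span_subset {X T : Set P} (hT : LS.IsSubspace T) (h : X ⊆ T) : LS.span X ⊆ T :=
  fun _ hA => hA T ⟨hT, h⟩

theorem span_subset_span {X Y : Set P} (h : X ⊆ LS.span Y) : LS.span X ⊆ LS.span Y :=
  span_subset (isSubspace_span Y) h

theorem line_subset_span {l : Set P} (hl : l ∈ LS.lines) {A B : P} (hAB : A ≠ B) (hA : A ∈ l)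
    (hB : B ∈ l) {X : Set P} (hAX : A ∈ LS.span X) (hBX : B ∈ LS.span X) : l ⊆ LS.span X :=
  isSubspace_span X l hl A hA B hB hAB hAX hBX

theorem exists_notMem_span (hdim : 3 ≤ LS.dim) {X : Set P} (hX : X.encard ≤ 3) :
    ∃ T, T ∉ LS.span X := by
  by_contra! h
  have h1 : LS.dim ≤ X.encard - 1 :=
    sInf_le ⟨X, Set.subset_univ X, Set.eq_univ_of_forall h, rfl⟩
  have h2 : X.encard - 1 ≤ 2 := tsub_le_iff_right.2 (hX.trans (by norm_num))
  exact absurd (hdim.trans (h1.trans h2)) (by decide)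

theorem encard_triple_le (A B C : P) : ({A, B, C} : Set P).encard ≤ 3 := by
  refine (Set.encard_insert_le _ _).trans ?_
  refine (add_le_add_left (Set.encard_insert_le _ _) 1).trans ?_
  rw [Set.encard_singleton]
  norm_num

theorem exists_span_union_eq {a b : Set P} (ha : a ∈ LS.lines) (hb : b ∈ LS.lines) {A : P}
    (hAa : A ∈ a) (hAb : A ∈ b) : ∃ B C, LS.span (a ∪ b) = LS.span {A, B, C} := by
  obtain ⟨B, hB, hBA⟩ := exists_mem_ne ha A
  obtain ⟨C, hC, hCA⟩ := exists_mem_ne hb A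
  refine ⟨B, C, Set.Subset.antisymm (span_subset_span (Set.union_subset ?_ ?_))
    (span_subset_span (Set.Subset.trans ?_ (subset_span _)))⟩
  · exact line_subset_span ha hBA hB hAa (subset_span _ (by simp)) (subset_span _ (by simp))
  · exact line_subset_span hb hCA hC hAb (subset_span _ (by simp)) (subset_span _ (by simp))
  · rintro x (rfl | rfl | rfl)
    · exact Or.inl hAa
    · exact Or.inl hB
    · exact Or.inr hC

theorem exists_notMem_span_union (hdim : 3 ≤ LS.dim) {a b : Set P} (ha : a ∈ LS.lines)
    (hb : b ∈ LS.lines) (hab : (a ∩ b).Nonempty) : ∃ T, T ∉ LS.span (a ∪ b) := by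
  obtain ⟨A, hAa, hAb⟩ := hab
  obtain ⟨B, C, h⟩ := exists_span_union_eq ha hb hAa hAb
  rw [h]
  exact exists_notMem_span hdim (encard_triple_le A B C)

theorem exists_ne_mem_star (hdim : 3 ≤ LS.dim) (A : P) :
    ∃ a ∈ LS.star A, ∃ b ∈ LS.star A, a ≠ b := by
  obtain ⟨B, hB⟩ := exists_notMem_span hdim (encard_triple_le A A A)
  obtain ⟨C, hC⟩ := exists_notMem_span hdim (encard_triple_le A B B)
  have hAB : A ≠ B := fun h => hB (subset_span _ (by simp [h]))
  have hAC : A ≠ C := fun h => hC (subset_span _ (by simp [h]))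
  obtain ⟨a, ha, hAa, hBa⟩ := LS.exists_line hAB
  obtain ⟨b, hb, hAb, hCb⟩ := LS.exists_line hAC
  refine ⟨a, ⟨ha, hAa⟩, b, ⟨hb, hAb⟩, ?_⟩
  rintro rfl
  exact hC (line_subset_span ha hAB hAa hBa (subset_span _ (by simp)) (subset_span _ (by simp)) hCb)

/-- In a space of dimension at least 3, stars of lines are maximal related sets. -/
theorem mem_of_forall_star_inter_nonempty (hdim : 3 ≤ LS.dim) {A : P} {c : Set P}
    (hc : c ∈ LS.lines) (h : ∀ a ∈ LS.star A, (a ∩ c).Nonempty) : A ∈ c := by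
  by_contra hA
  obtain ⟨C, hC⟩ := nonempty_of_mem_lines hc
  have hAC : A ≠ C := fun h => hA (h ▸ hC)
  obtain ⟨a, ha, hAa, hCa⟩ := LS.exists_line hAC
  obtain ⟨T, hT⟩ := exists_notMem_span_union hdim ha hc ⟨C, hCa, hC⟩
  have hAT : A ≠ T := fun h => hT (subset_span _ (Or.inl (h ▸ hAa)))
  obtain ⟨t, ht, hAt, hTt⟩ := LS.exists_line hAT
  obtain ⟨X, hXt, hXc⟩ := h t ⟨ht, hAt⟩
  have hAX : A ≠ X := fun h => hA (h ▸ hXc)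
  exact hT (line_subset_span ht hAX hAt hXt (subset_span _ (Or.inl hAa))
    (subset_span _ (Or.inr hXc)) hTt)

/-- Two distinct lines of a related set without a common point span a subspace containing
all its lines. -/
theorem IsRelatedSet.subset_span_union {M : Set (Set P)} (hM : LS.IsRelatedSet M)
    (hcommon : ∀ C, ∃ m ∈ M, C ∉ m) {a b : Set P} (ha : a ∈ M) (hb : b ∈ M) (hab : a ≠ b)
    {d : Set P} (hd : d ∈ M) : d ⊆ LS.span (a ∪ b) := by
  obtain ⟨Z, hZa, hZb⟩ := hM.2 a ha b hb
  have key : ∀ d ∈ M, Z ∉ d → d ⊆ LS.span (a ∪ b) := by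
    intro d hd hZd
    obtain ⟨X, hXd, hXa⟩ := hM.2 d hd a ha
    obtain ⟨Y, hYd, hYb⟩ := hM.2 d hd b hb
    have hXY : X ≠ Y := by
      rintro rfl
      exact hab (eq_of_mem (hM.1 ha) (hM.1 hb) (fun h : X = Z => hZd (h ▸ hXd)) hXa hZa hYb hZb)
    exact line_subset_span (hM.1 hd) hXY hXd hYd (subset_span _ (Or.inl hXa))
      (subset_span _ (Or.inr hYb))
  by_cases hZd : Z ∈ d
  · obtain ⟨e, he, hZe⟩ := hcommon Z
    obtain ⟨X, hXd, hXe⟩ := hM.2 d hd e he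
    exact line_subset_span (hM.1 hd) (fun h : X = Z => hZe (h ▸ hXe)) hXd hZd
      (key e he hZe hXe) (subset_span _ (Or.inl hZa))
  · exact key d hd hZd

/-- A bijection between the line sets preserving relatedness in both directions. -/
structure IsRelatedIso (LS : LinearSpace P) (LS' : LinearSpace P') (φ : Set P → Set P') :
    Prop where
  bijOn : Set.BijOn φ LS.lines LS'.lines
  related_iff : ∀ a ∈ LS.lines, ∀ b ∈ LS.lines, ((a ∩ b).Nonempty ↔ (φ a ∩ φ b).Nonempty)

namespace IsRelatedIso

variable {φ : Set P → Set P'}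

theorem exists_inverse (h : IsRelatedIso LS LS' φ) :
    ∃ ψ, IsRelatedIso LS' LS ψ ∧ Set.InvOn ψ φ LS.lines LS'.lines := by
  have hinv := h.bijOn.invOn_invFunOn
  refine ⟨Function.invFunOn φ LS.lines, ⟨(Set.bijOn_comm hinv).2 h.bijOn, ?_⟩, hinv⟩
  intro a ha b hb
  have hmaps := ((Set.bijOn_comm hinv).2 h.bijOn).mapsTo
  rw [h.related_iff _ (hmaps ha) _ (hmaps hb), hinv.2 ha, hinv.2 hb]

theorem isRelatedSet_image_star (h : IsRelatedIso LS LS' φ) (A : P) :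
    LS'.IsRelatedSet (φ '' LS.star A) := by
  constructor
  · rintro _ ⟨a, ha, rfl⟩
    exact h.bijOn.mapsTo ha.1
  · rintro _ ⟨a, ha, rfl⟩ _ ⟨b, hb, rfl⟩
    exact (h.related_iff a ha.1 b hb.1).1 ⟨A, ha.2, hb.2⟩

theorem mem_of_map_mem_image_star (h : IsRelatedIso LS LS' φ) {A : P} {a : Set P}
    (ha : a ∈ LS.lines) (ha' : φ a ∈ φ '' LS.star A) : A ∈ a := by
  obtain ⟨b, hb, hba⟩ := ha'
  exact h.bijOn.injOn hb.1 ha hba ▸ hb.2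

/-- If the image of a star is not a star, then its lines have no common point. -/
theorem exists_mem_image_star_notMem (h : IsRelatedIso LS LS' φ) (hdim : 3 ≤ LS.dim) {A : P}
    (hA : ∀ A', φ '' LS.star A ≠ LS'.star A') (C : P') : ∃ m ∈ φ '' LS.star A, C ∉ m := by
  by_contra! hC
  refine hA C (Set.Subset.antisymm
    (fun m hm => ⟨(h.isRelatedSet_image_star A).1 hm, hC m hm⟩) ?_)
  rintro _ ⟨hc', hCc⟩
  obtain ⟨c, hc, rfl⟩ := h.bijOn.surjOn hc'
  refine ⟨c, ⟨hc, mem_of_forall_star_inter_nonempty hdim hc fun a ha => ?_⟩, rfl⟩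
  exact (h.related_iff a ha.1 c hc).2 ⟨C, hC _ ⟨a, ha, rfl⟩, hCc⟩

theorem image_subset_span_union (h : IsRelatedIso LS LS' φ) (hdim : 3 ≤ LS.dim) {A : P}
    (hA : ∀ A', φ '' LS.star A ≠ LS'.star A') {a b d : Set P} (ha : a ∈ LS.star A)
    (hb : b ∈ LS.star A) (hab : a ≠ b) (hd : d ∈ LS.star A) :
    φ d ⊆ LS'.span (φ a ∪ φ b) :=
  (h.isRelatedSet_image_star A).subset_span_union (h.exists_mem_image_star_notMem hdim hA)
    ⟨a, ha, rfl⟩ ⟨b, hb, rfl⟩ (fun e => hab (h.bijOn.injOn ha.1 hb.1 e)) ⟨d, hd, rfl⟩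

theorem exists_notMem_span_map (h : IsRelatedIso LS LS' φ) (hdim' : 3 ≤ LS'.dim) {A : P}
    {a b : Set P} (ha : a ∈ LS.star A) (hb : b ∈ LS.star A) :
    ∃ T, T ∉ LS'.span (φ a ∪ φ b) :=
  exists_notMem_span_union hdim' (h.bijOn.mapsTo ha.1) (h.bijOn.mapsTo hb.1)
    ((h.related_iff a ha.1 b hb.1).1 ⟨A, ha.2, hb.2⟩)

/-- If the image of one star is not a star, then no star is mapped onto a star. -/
theorem image_star_ne_star (h : IsRelatedIso LS LS' φ) (hdim : 3 ≤ LS.dim) (hdim' : 3 ≤ LS'.dim)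
    {A : P} (hA : ∀ A', φ '' LS.star A ≠ LS'.star A') (B : P) (B' : P') :
    φ '' LS.star B ≠ LS'.star B' := by
  intro hB
  have hAB : A ≠ B := by
    rintro rfl
    exact hA B' hB
  obtain ⟨a, ha, b, hb, hab⟩ := exists_ne_mem_star hdim A
  have hsub : ∀ d ∈ LS.star A, φ d ⊆ LS'.span (φ a ∪ φ b) := fun d hd =>
    h.image_subset_span_union hdim hA ha hb hab hd
  obtain ⟨T, hT⟩ := h.exists_notMem_span_map hdim' ha hb
  obtain ⟨l, hl, hAl, hBl⟩ := LS.exists_line hAB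
  have hl' : φ l ∈ LS'.star B' := hB ▸ ⟨l, ⟨hl, hBl⟩, rfl⟩
  have hB'span := hsub l ⟨hl, hAl⟩ hl'.2
  obtain ⟨y', hy', hB'y, hTy⟩ := LS'.exists_line (fun e : B' = T => hT (e ▸ hB'span))
  have hyB : y' ∈ φ '' LS.star B := hB ▸ ⟨hy', hB'y⟩
  obtain ⟨y, ⟨hy, hBy⟩, rfl⟩ := hyB
  have hAy : A ∉ y := fun e => hT (hsub y ⟨hy, e⟩ hTy)
  obtain ⟨Y, hYy, hYB⟩ := exists_mem_ne hy B
  obtain ⟨x, hx, hAx, hYx⟩ := LS.exists_line (fun e : A = Y => hAy (e ▸ hYy))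
  obtain ⟨Z, hZx, hZy⟩ := (h.related_iff x hx y hy).1 ⟨Y, hYx, hYy⟩
  have hZB : Z = B' := by
    by_contra hne
    exact hT (line_subset_span hy' hne hZy hB'y (hsub x ⟨hx, hAx⟩ hZx) hB'span hTy)
  have hxB : φ x ∈ φ '' LS.star B := hB ▸ ⟨h.bijOn.mapsTo hx, hZB ▸ hZx⟩
  have hBx := h.mem_of_map_mem_image_star hx hxB
  exact hAy (eq_of_mem hx hy hYB hYx hBx hYy hBy ▸ hAx)

theorem inter_span_map_nonempty (h : IsRelatedIso LS LS' φ) (hdim : 3 ≤ LS.dim) {Q : P}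
    (hQ : ∀ A', φ '' LS.star Q ≠ LS'.star A') {a b : Set P} (ha : a ∈ LS.star Q)
    (hb : b ∈ LS.star Q) (hab : a ≠ b) {t' : Set P'} (ht' : t' ∈ LS'.lines) :
    (t' ∩ LS'.span (φ a ∪ φ b)).Nonempty := by
  obtain ⟨t, ht, rfl⟩ := h.bijOn.surjOn ht'
  obtain ⟨Y, hYt, hYQ⟩ := exists_mem_ne ht Q
  obtain ⟨x, hx, hYx, hQx⟩ := LS.exists_line hYQ
  obtain ⟨Z, hZt, hZx⟩ := (h.related_iff t ht x hx).1 ⟨Y, hYt, hYx⟩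
  exact ⟨Z, hZt, h.image_subset_span_union hdim hQ ha hb hab ⟨hx, hQx⟩ hZx⟩

/-- If no star is mapped onto a star, then the image of a star consists of all lines of the
plane spanned by two of its lines. -/
theorem mem_image_star_of_subset_span (h : IsRelatedIso LS LS' φ) (hdim : 3 ≤ LS.dim)
    (hdim' : 3 ≤ LS'.dim) (hne : ∀ B B', φ '' LS.star B ≠ LS'.star B') {Q : P} {a b : Set P}
    (ha : a ∈ LS.star Q) (hb : b ∈ LS.star Q) (hab : a ≠ b) {g' : Set P'} (hg' : g' ∈ LS'.lines)
    (hgspan : g' ⊆ LS'.span (φ a ∪ φ b)) : g' ∈ φ '' LS.star Q := by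
  obtain ⟨g, hg, rfl⟩ := h.bijOn.surjOn hg'
  refine ⟨g, ⟨hg, ?_⟩, rfl⟩
  by_contra hQg
  obtain ⟨T, hT⟩ := h.exists_notMem_span_map hdim' ha hb
  obtain ⟨W, hW⟩ := nonempty_of_mem_lines hg'
  obtain ⟨t', ht', hWt, hTt⟩ := LS'.exists_line (fun e : W = T => hT (e ▸ hgspan hW))
  obtain ⟨t, ht, rfl⟩ := h.bijOn.surjOn ht'
  obtain ⟨G, hGt, hGg⟩ := (h.related_iff t ht g hg).2 ⟨W, hWt, hW⟩
  obtain ⟨x, hx, hQx, hGx⟩ := LS.exists_line (fun e : Q = G => hQg (e ▸ hGg))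
  have hgx : g ≠ x := fun e => hQg (e ▸ hQx)
  have hx' := h.image_subset_span_union hdim (hne Q) ha hb hab ⟨hx, hQx⟩
  exact hT (span_subset_span (Set.union_subset hgspan hx')
    (h.image_subset_span_union hdim (hne G) ⟨hg, hGg⟩ ⟨hx, hGx⟩ hgx ⟨ht, hGt⟩ hTt))

end IsRelatedIso

/-- Every plane is spanned by two distinct lines with a common point. -/
theorem IsPlane.exists_span_union_eq {E : Set P} (hE : LS.IsPlane E) :
    ∃ Q, ∃ a ∈ LS.star Q, ∃ b ∈ LS.star Q, a ≠ b ∧ LS.span (a ∪ b) = E := by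
  obtain ⟨-, hE⟩ := hE
  have hne : {d : ℕ∞ | ∃ X : Set P, X ⊆ E ∧ LS.span X = E ∧ d = X.encard - 1}.Nonempty := by
    by_contra hempty
    rw [sdim, Set.not_nonempty_iff_eq_empty.1 hempty, sInf_empty] at hE
    exact absurd hE (by decide)
  obtain ⟨X, hXE, hX, hcard⟩ := csInf_mem hne
  rw [← sdim, hE] at hcard
  have hcard3 : X.encard = 3 := by
    cases hn : X.encard with
    | top => rw [hn] at hcard; exact absurd hcard (by decide)
    | coe n =>
      rw [hn] at hcard
      have h2 : 2 = n - 1 := by exact_mod_cast hcard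
      have h3 : n = 3 := by omega
      rw [h3]; rfl
  obtain ⟨Q, R, S, hQR, hQS, -, rfl⟩ := Set.encard_eq_three.1 hcard3
  have hS : S ∉ LS.span {Q, R} := by
    intro hS
    have hspan : LS.span {Q, R} = E := by
      rw [← hX]
      refine Set.Subset.antisymm (span_subset_span (Set.Subset.trans ?_ (subset_span _)))
        (span_subset_span ?_)
      · rintro x (rfl | rfl) <;> simp
      · rintro x (rfl | rfl | rfl)
        · exact subset_span _ (by simp)
        · exact subset_span _ (by simp)
        · exact hS
    have hle : LS.sdim E ≤ ({Q, R} : Set P).encard - 1 :=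
      sInf_le ⟨_, hspan ▸ subset_span _, hspan, rfl⟩
    rw [hE, Set.encard_pair hQR] at hle
    exact absurd hle (by decide)
  obtain ⟨a, ha, hQa, hRa⟩ := LS.exists_line hQR
  obtain ⟨b, hb, hQb, hSb⟩ := LS.exists_line hQS
  refine ⟨Q, a, ⟨ha, hQa⟩, b, ⟨hb, hQb⟩, ?_, ?_⟩
  · rintro rfl
    exact hS (line_subset_span ha hQR hQa hRa (subset_span _ (by simp)) (subset_span _ (by simp))
      hSb)
  · rw [← hX]
    refine Set.Subset.antisymm (span_subset_span (Set.union_subset ?_ ?_))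
      (span_subset_span (Set.Subset.trans ?_ (subset_span _)))
    · exact line_subset_span ha hQR hQa hRa (subset_span _ (by simp)) (subset_span _ (by simp))
    · exact line_subset_span hb hQS hQb hSb (subset_span _ (by simp)) (subset_span _ (by simp))
    · rintro x (rfl | rfl | rfl)
      · exact Or.inl hQa
      · exact Or.inl hRa
      · exact Or.inr hSb

/-- A space with two intersecting lines whose span meets every line has dimension at most 3. -/
theorem dim_le_three {a b : Set P} (ha : a ∈ LS.lines) (hb : b ∈ LS.lines)
    (hab : (a ∩ b).Nonempty) (hmeet : ∀ t ∈ LS.lines, (t ∩ LS.span (a ∪ b)).Nonempty)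
    {T : P} (hT : T ∉ LS.span (a ∪ b)) : LS.dim ≤ 3 := by
  obtain ⟨A, hAa, hAb⟩ := hab
  obtain ⟨B, C, hspan⟩ := exists_span_union_eq ha hb hAa hAb
  rw [hspan] at hmeet hT
  have huniv : LS.span {T, A, B, C} = Set.univ := by
    refine Set.eq_univ_of_forall fun W => ?_
    by_cases hWT : W = T
    · exact subset_span _ (by simp [hWT])
    obtain ⟨t, ht, hWt, hTt⟩ := LS.exists_line hWT
    obtain ⟨Z, hZt, hZ⟩ := hmeet t ht
    exact line_subset_span ht (fun e : Z = T => hT (e ▸ hZ)) hZt hTt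
      (span_subset_span ((Set.subset_insert _ _).trans (subset_span _)) hZ)
      (subset_span _ (by simp)) hWt
  have hle : LS.dim ≤ ({T, A, B, C} : Set P).encard - 1 :=
    sInf_le ⟨_, Set.subset_univ _, huniv, rfl⟩
  refine hle.trans (tsub_le_iff_right.2 ((Set.encard_insert_le _ _).trans ?_))
  exact add_le_add_left (encard_triple_le A B C) 1

end LinearSpace

/-- If a relatedness-preserving line bijection `φ` (both directions, dimensions
at least 3) maps some star of lines onto a coplanar maximal related set, then
`(P, L)` is itself a 3-dimensional generalized projective space. -/
theorem source_genProjSpace_of_star_to_coplanar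
    {P P' : Type*} (LS : LinearSpace P) (LS' : LinearSpace P')
    (hdim : 3 ≤ LS.dim) (hdim' : 3 ≤ LS'.dim)
    (φ : Set P → Set P') (hbij : Set.BijOn φ LS.lines LS'.lines)
    (hrel : ∀ a ∈ LS.lines, ∀ b ∈ LS.lines,
      ((a ∩ b).Nonempty ↔ (φ a ∩ φ b).Nonempty))
    (hstar : ∃ A : P, LS'.IsMaxRelatedSet (φ '' LS.star A) ∧
      ∀ A' : P', φ '' LS.star A ≠ LS'.star A') :
    LS.dim = 3 ∧ LS.IsGenProjSpace := by
  have hφ : LinearSpace.IsRelatedIso LS LS' φ := ⟨hbij, hrel⟩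
  obtain ⟨A, -, hA⟩ := hstar
  have hne := hφ.image_star_ne_star hdim hdim' hA
  obtain ⟨ψ, hψ, hinv⟩ := hφ.exists_inverse
  have hne' : ∀ B' B, ψ '' LS'.star B' ≠ LS.star B := by
    intro B' B hB
    refine hne B B' ?_
    rw [← hB]
    exact (hinv.2.mono fun _ hl => hl.1).image_image
  have hvertex : ∀ Q, ∀ a ∈ LS.star Q, ∀ b ∈ LS.star Q,
      ∃ A', φ a ∈ LS'.star A' ∧ φ b ∈ LS'.star A' := by
    intro Q a ha b hb
    obtain ⟨A', ha', hb'⟩ := (hrel a ha.1 b hb.1).1 ⟨Q, ha.2, hb.2⟩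
    exact ⟨A', ⟨hbij.mapsTo ha.1, ha'⟩, ⟨hbij.mapsTo hb.1, hb'⟩⟩
  constructor
  · obtain ⟨a, ha, b, hb, hab⟩ := LinearSpace.exists_ne_mem_star hdim A
    obtain ⟨A', ha', hb'⟩ := hvertex A a ha b hb
    have hmeet : ∀ t ∈ LS.lines, (t ∩ LS.span (a ∪ b)).Nonempty := by
      intro t ht
      have := hψ.inter_span_map_nonempty hdim' (hne' A') ha' hb'
        (fun e => hab (hbij.injOn ha.1 hb.1 e)) ht
      rwa [hinv.1 ha.1, hinv.1 hb.1] at this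
    have hnonempty : (a ∩ b).Nonempty := ⟨A, ha.2, hb.2⟩
    obtain ⟨T, hT⟩ := LinearSpace.exists_notMem_span_union hdim ha.1 hb.1 hnonempty
    exact le_antisymm (LinearSpace.dim_le_three ha.1 hb.1 hnonempty hmeet hT) hdim
  · intro E hE l hl m hm hlE hmE _
    obtain ⟨Q, a, ha, b, hb, hab, rfl⟩ := hE.exists_span_union_eq
    obtain ⟨A', ha', hb'⟩ := hvertex Q a ha b hb
    have hmem : ∀ g ∈ LS.lines, g ⊆ LS.span (a ∪ b) → g ∈ ψ '' LS'.star A' := by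
      intro g hg hgE
      refine hψ.mem_image_star_of_subset_span hdim' hdim hne' ha' hb'
        (fun e => hab (hbij.injOn ha.1 hb.1 e)) hg ?_
      rwa [hinv.1 ha.1, hinv.1 hb.1]
    exact (hψ.isRelatedSet_image_star A').2 l (hmem l hl hlE) m (hmem m hm hmE)
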